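/- arXiv:0804.1235 — 6 statements merged into one kernel-verified Lean document; each statement's English description precedes it below -/
import Mathlib

section
/- Let e, f ∈ V with q(e) = q(f) = 0 and B(e,f) = 1, let λ ∈ F with λ ≠ 0, and set u = ι(e+f)·ι(e+λf) in C(V,q). Then u·ι(e) = λ·(ι(e)·u), λ·(u·ι(f)) = ι(f)·u, and u·ι(x) = ι(x)·u for every x ∈ V with B(e,x) = 0 = B(f,x). (Thus under the vector representation, u acts on V by scaling e by λ, scaling f by λ⁻¹, and fixing the orthogonal complement of span{e,f}.) -/
open CliffordAlgebra

/-- For isotropic vectors `e, f` with `B(e,f) = 1` and `λ ≠ 0`, the element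
`u = ι(e+f)·ι(e+λf)` of the Clifford algebra satisfies `u·ι(e) = λ·(ι(e)·u)`,
`λ·(u·ι(f)) = ι(f)·u`, and commutes with `ι(x)` for `x` orthogonal to both `e` and `f`. -/
theorem stmt0 {F V : Type*} [Field F] [AddCommGroup V] [Module F V] [FiniteDimensional F V]
    (hF2 : (2 : F) ≠ 0) (Q : QuadraticForm F V)
    (e f : V) (he : Q e = 0) (hf : Q f = 0) (hef : QuadraticMap.polar Q e f = 1)
    (l : F) (hl : l ≠ 0) (u : CliffordAlgebra Q)
    (hu : u = ι Q (e + f) * ι Q (e + l • f)) :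
    u * ι Q e = l • (ι Q e * u) ∧
    l • (u * ι Q f) = ι Q f * u ∧
    ∀ x : V, QuadraticMap.polar Q e x = 0 → QuadraticMap.polar Q f x = 0 →
      u * ι Q x = ι Q x * u := by
  have haa : ι Q e * ι Q e = 0 := by rw [ι_sq_scalar, he, map_zero]
  have hbb : ι Q f * ι Q f = 0 := by rw [ι_sq_scalar, hf, map_zero]
  have hab : ι Q e * ι Q f + ι Q f * ι Q e = 1 := by rw [ι_mul_ι_add_swap, hef, map_one]
  have hax : ∀ x, QuadraticMap.polar Q e x = 0 → ι Q e * ι Q x = -(ι Q x * ι Q e) := by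
    intro x hx
    rw [eq_neg_iff_add_eq_zero, ι_mul_ι_add_swap, hx, map_zero]
  have hbx : ∀ x, QuadraticMap.polar Q f x = 0 → ι Q f * ι Q x = -(ι Q x * ι Q f) := by
    intro x hx
    rw [eq_neg_iff_add_eq_zero, ι_mul_ι_add_swap, hx, map_zero]
  have hu' : u = l • (ι Q e * ι Q f) + ι Q f * ι Q e := by
    rw [hu]
    simp only [map_add, map_smul, add_mul, mul_add, mul_smul_comm, haa, hbb]
    rw [zero_add, add_zero, add_comm]
  clear hu
  generalize ι Q e = a at *
  generalize ι Q f = b at *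
  have haba : a * (b * a) = a := by
    have : b * a = 1 - a * b := eq_sub_of_add_eq' hab
    rw [this, mul_sub, ← mul_assoc, haa]; simp
  have hbab : b * (a * b) = b := by
    have : a * b = 1 - b * a := eq_sub_of_add_eq hab
    rw [this, mul_sub, ← mul_assoc, hbb]; simp
  subst hu'
  refine ⟨?_, ?_, ?_⟩
  · simp only [add_mul, mul_add, smul_mul_assoc, mul_smul_comm, mul_assoc, haba, haa]
    simp [← mul_assoc, haa]
  · simp only [add_mul, mul_add, smul_mul_assoc, mul_smul_comm, mul_assoc, hbab, hbb]
    simp [← mul_assoc, hbb]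
  · intro x h1 h2
    have h1 := hax x h1
    have h2 := hbx x h2
    generalize ι Q x = c at *
    have e1 : a * b * c = c * (a * b) := by
      rw [mul_assoc, h2, mul_neg, ← mul_assoc, h1, neg_mul, neg_neg, mul_assoc]
    have e2 : b * a * c = c * (b * a) := by
      rw [mul_assoc, h1, mul_neg, ← mul_assoc, h2, neg_mul, neg_neg, mul_assoc]
    rw [add_mul, mul_add, smul_mul_assoc, mul_smul_comm, e1, e2]
end

section
/- Let e, f ∈ V with q(e) = q(f) = 0 and B(e,f) = 1. Then for all λ, μ ∈ F one has (ι(e+f)·ι(e+λf))·(ι(e+f)·ι(e+μf)) = ι(e+f)·ι(e+λμf) in C(V,q). Moreover, if e′, f′ ∈ V also satisfy q(e′) = q(f′) = 0, B(e′,f′) = 1, and B(x,y) = 0 for all x ∈ {e,f}, y ∈ {e′,f′}, then ι(e+f)·ι(e+λf) commutes with ι(e′+f′)·ι(e′+μf′) for all λ, μ ∈ F. -/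
open CliffordAlgebra

theorem aux_prod {F A : Type*} [Field F] [Ring A] [Algebra F A] (a b : A)
    (ha : a * a = 0) (hb : b * b = 0) (l : F) :
    (a + b) * (a + l • b) = b * a + l • (a * b) := by
  simp [add_mul, mul_add, ha, hb, add_comm]

theorem aux_mul {F A : Type*} [Field F] [Ring A] [Algebra F A] (a b : A)
    (ha : a * a = 0) (hb : b * b = 0) (hab : a * b + b * a = 1) (l m : F) :
    (b * a + l • (a * b)) * (b * a + m • (a * b)) = b * a + (l * m) • (a * b) := by
  have h1 : (b * a) * (a * b) = 0 := by
    rw [mul_assoc, ← mul_assoc a a, ha, zero_mul, mul_zero]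
  have h2 : (a * b) * (b * a) = 0 := by
    rw [mul_assoc, ← mul_assoc b b, hb, zero_mul, mul_zero]
  have h3 : (b * a) * (b * a) = b * a := by
    have h := congrArg (fun x => x * (b * a)) hab
    simpa [add_mul, h2] using h
  have h4 : (a * b) * (a * b) = a * b := by
    have h := congrArg (fun x => x * (a * b)) hab
    simpa [add_mul, h1] using h
  simp only [add_mul, mul_add, smul_mul_assoc, mul_smul_comm, h1, h2, h3, h4, smul_zero,
    add_zero, zero_add, smul_smul, mul_comm m l]

theorem aux_comm {A : Type*} [Ring A] (x y z w : A) (hxz : x * z = -(z * x))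
    (hxw : x * w = -(w * x)) (hyz : y * z = -(z * y)) (hyw : y * w = -(w * y)) :
    (x * y) * (z * w) = (z * w) * (x * y) := by
  have h1 : y * (z * w) = (z * w) * y := by
    rw [← mul_assoc, hyz, neg_mul, mul_assoc, hyw, mul_neg, neg_neg, mul_assoc]
  have h2 : x * (z * w) = (z * w) * x := by
    rw [← mul_assoc, hxz, neg_mul, mul_assoc, hxw, mul_neg, neg_neg, mul_assoc]
  rw [mul_assoc, h1, ← mul_assoc, h2, mul_assoc]

/-- For isotropic vectors `e, f` with `B(e,f) = 1`, the elements
`ι(e+f)·ι(e+λf)` multiply according to `λ·μ`, and such elements built from mutually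
orthogonal hyperbolic pairs commute. -/
theorem stmt1 {F V : Type*} [Field F] [AddCommGroup V] [Module F V] [FiniteDimensional F V]
    (hF2 : (2 : F) ≠ 0) (Q : QuadraticForm F V)
    (e f : V) (he : Q e = 0) (hf : Q f = 0) (hef : QuadraticMap.polar Q e f = 1) :
    (∀ l m : F,
      (ι Q (e + f) * ι Q (e + l • f)) * (ι Q (e + f) * ι Q (e + m • f))
        = ι Q (e + f) * ι Q (e + (l * m) • f)) ∧
    (∀ e' f' : V, Q e' = 0 → Q f' = 0 → QuadraticMap.polar Q e' f' = 1 →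
      QuadraticMap.polar Q e e' = 0 → QuadraticMap.polar Q e f' = 0 →
      QuadraticMap.polar Q f e' = 0 → QuadraticMap.polar Q f f' = 0 →
      ∀ l m : F,
        (ι Q (e + f) * ι Q (e + l • f)) * (ι Q (e' + f') * ι Q (e' + m • f'))
          = (ι Q (e' + f') * ι Q (e' + m • f')) * (ι Q (e + f) * ι Q (e + l • f))) := by
  have sq : ∀ v, Q v = 0 → ι Q v * ι Q v = 0 := fun v hv => by
    rw [ι_sq_scalar, hv, map_zero]
  refine ⟨fun l m => ?_, ?_⟩
  · have hab : ι Q e * ι Q f + ι Q f * ι Q e = 1 := by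
      rw [ι_mul_ι_add_swap, hef, map_one]
    simp only [map_add, map_smul]
    rw [aux_prod _ _ (sq e he) (sq f hf), aux_prod _ _ (sq e he) (sq f hf),
      aux_prod _ _ (sq e he) (sq f hf), aux_mul _ _ (sq e he) (sq f hf) hab]
  · intro e' f' _ _ _ h1 h2 h3 h4 l m
    have key : ∀ s t : F, ∀ s' t' : F,
        ι Q (s • e + t • f) * ι Q (s' • e' + t' • f')
          = -(ι Q (s' • e' + t' • f') * ι Q (s • e + t • f)) := by
      intro s t s' t'
      apply eq_neg_of_add_eq_zero_left
      rw [ι_mul_ι_add_swap]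
      simp [QuadraticMap.polar_add_left, QuadraticMap.polar_add_right,
        QuadraticMap.polar_smul_left, QuadraticMap.polar_smul_right, h1, h2, h3, h4]
    have k1 := key 1 1 1 1
    have k2 := key 1 1 1 m
    have k3 := key 1 l 1 1
    have k4 := key 1 l 1 m
    simp only [one_smul] at k1 k2 k3 k4
    exact aux_comm _ _ _ _ k1 k2 k3 k4
end

section
/- Let e₁, f₁, …, e_m, f_m ∈ V satisfy q(e_i) = q(f_i) = 0, B(e_i, f_j) = δ_{ij}, and B(e_i, e_j) = 0 = B(f_i, f_j) for all i, j. Let β, α₁, …, α_m ∈ F be nonzero and set t = β · ∏_{i=1}^m ι(e_i+f_i)·ι(e_i+α_i f_i) and s = ∏_{i=1}^m ι(e_i+f_i) in C(V,q). Then: (1) s·t = reverse(t)·s; (2) reverse(s)·s = 1; (3) s² = (−1)^{m(m−1)/2}; (4) reverse(t)·t = β²·∏_{i=1}^m α_i. (In particular s conjugates t to N(t)·t⁻¹ and N(s) = 1.) -/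
open CliffordAlgebra

theorem stmt3_anti {F V : Type*} [Field F] [AddCommGroup V] [Module F V]
    (Q : QuadraticForm F V) (v : V) : ∀ (m : ℕ) (a : Fin m → V)
    (_ : ∀ i, QuadraticMap.polar Q v (a i) = 0),
    ι Q v * (List.ofFn fun i => ι Q (a i)).prod
      = (-1 : CliffordAlgebra Q) ^ m * ((List.ofFn fun i => ι Q (a i)).prod * ι Q v) := by
  intro m
  induction m with
  | zero => intro a _; simp
  | succ m ih =>
    intro a h
    have h1 := ih (fun i => a i.succ) (fun i => h i.succ)
    have h2 : ι Q v * ι Q (a 0) = -(ι Q (a 0) * ι Q v) := by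
      rw [ι_mul_ι_comm, h 0]; simp
    rw [List.ofFn_succ, List.prod_cons, ← mul_assoc, h2, neg_mul, mul_assoc, h1, pow_succ]
    have hc : Commute ((-1 : CliffordAlgebra Q) ^ m) (ι Q (a 0)) :=
      (Commute.neg_one_left _).pow_left m
    rw [← mul_assoc (ι Q (a 0)), ← hc.eq]
    simp only [mul_assoc, neg_mul, mul_neg, one_mul]

theorem stmt3_comm {F V : Type*} [Field F] [AddCommGroup V] [Module F V]
    (Q : QuadraticForm F V) (v : V) : ∀ (m : ℕ) (a b : Fin m → V)
    (_ : ∀ i, QuadraticMap.polar Q v (a i) = 0)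
    (_ : ∀ i, QuadraticMap.polar Q v (b i) = 0),
    Commute (ι Q v) (List.ofFn fun i => ι Q (a i) * ι Q (b i)).prod := by
  intro m a b ha hb
  apply Commute.list_prod_right
  intro x hx
  obtain ⟨i, rfl⟩ := (List.mem_ofFn' _ _).1 hx
  have h1 : ι Q v * ι Q (a i) = -(ι Q (a i) * ι Q v) := by
    rw [ι_mul_ι_comm, ha i]; simp
  have h2 : ι Q v * ι Q (b i) = -(ι Q (b i) * ι Q v) := by
    rw [ι_mul_ι_comm, hb i]; simp
  change _ * (_ * _) = (_ * _) * _
  rw [← mul_assoc, h1, neg_mul, mul_assoc, h2, mul_neg, neg_neg, mul_assoc]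

theorem stmt3_aux {F V : Type*} [Field F] [AddCommGroup V] [Module F V]
    (Q : QuadraticForm F V) : ∀ (m : ℕ) (a b : Fin m → V) (α : Fin m → F)
    (_ : ∀ i, Q (a i) = 1) (_ : ∀ i, Q (b i) = α i)
    (_ : ∀ i j, i ≠ j → QuadraticMap.polar Q (a i) (a j) = 0)
    (_ : ∀ i j, i ≠ j → QuadraticMap.polar Q (a i) (b j) = 0)
    (_ : ∀ i j, i ≠ j → QuadraticMap.polar Q (b i) (b j) = 0)
    (t s : CliffordAlgebra Q)
    (_ : t = (List.ofFn fun i => ι Q (a i) * ι Q (b i)).prod)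
    (_ : s = (List.ofFn fun i => ι Q (a i)).prod),
    s * t = reverse t * s ∧
    reverse s * s = 1 ∧
    s ^ 2 = (-1 : CliffordAlgebra Q) ^ (m * (m - 1) / 2) ∧
    reverse t * t = algebraMap F (CliffordAlgebra Q) (∏ i, α i) := by
  intro m
  induction m with
  | zero => intro a b α _ _ _ _ _ t s ht hs; subst ht hs; simp
  | succ m ih =>
    intro a b α ha hb haa hab hbb t s ht hs
    rw [List.ofFn_succ, List.prod_cons] at ht hs
    have hne : ∀ i : Fin m, (0 : Fin (m + 1)) ≠ i.succ := fun i => (Fin.succ_ne_zero i).symm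
    have hba : ∀ i j, i ≠ j → QuadraticMap.polar Q (b i) (a j) = 0 := fun i j h => by
      rw [QuadraticMap.polar_comm]; exact hab j i h.symm
    have ca := stmt3_anti Q (a 0) m (fun i => a i.succ) (fun i => haa _ _ (hne i))
    have cb := stmt3_anti Q (b 0) m (fun i => a i.succ) (fun i => hba _ _ (hne i))
    have db := stmt3_comm Q (b 0) m (fun i => a i.succ) (fun i => b i.succ)
      (fun i => hba _ _ (hne i)) (fun i => hbb _ _ (hne i))
    obtain ⟨i1, i2, i3, i4⟩ := ih (fun i => a i.succ) (fun i => b i.succ) (fun i => α i.succ)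
      (fun i => ha _) (fun i => hb _)
      (fun i j h => haa _ _ (by simpa using h))
      (fun i j h => hab _ _ (by simpa using h))
      (fun i j h => hbb _ _ (by simpa using h)) _ _ rfl rfl
    generalize (List.ofFn fun i : Fin m => ι Q (a i.succ) * ι Q (b i.succ)).prod = T at *
    generalize (List.ofFn fun i : Fin m => ι Q (a i.succ)).prod = S at *
    have aa : ι Q (a 0) * ι Q (a 0) = 1 := by rw [ι_sq_scalar, ha]; simp
    have bb : ι Q (b 0) * ι Q (b 0) = algebraMap F _ (α 0) := by rw [ι_sq_scalar, hb]
    have drb : ι Q (b 0) * reverse T = reverse T * ι Q (b 0) := by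
      have := congrArg reverse db.eq
      simpa [reverse.map_mul] using this.symm
    have rt : reverse t = reverse T * (ι Q (b 0) * ι Q (a 0)) := by
      rw [ht]; simp [reverse.map_mul]
    have rs : reverse s = reverse S * ι Q (a 0) := by
      rw [hs]; simp [reverse.map_mul]
    have nn : (-1 : CliffordAlgebra Q) ^ m * (-1) ^ m = 1 := by
      rw [← pow_add, ← two_mul, pow_mul]; simp
    have hc : ∀ x, (-1 : CliffordAlgebra Q) ^ m * x = x * (-1) ^ m := fun x =>
      ((Commute.neg_one_left x).pow_left m).eq
    have cab : S * (ι Q (a 0) * ι Q (b 0)) = ι Q (a 0) * ι Q (b 0) * S := by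
      symm
      calc ι Q (a 0) * ι Q (b 0) * S = ι Q (a 0) * (-1) ^ m * (S * ι Q (b 0)) := by
            rw [mul_assoc, cb, mul_assoc]
        _ = (-1) ^ m * (ι Q (a 0) * S) * ι Q (b 0) := by rw [← hc]; simp only [mul_assoc]
        _ = ((-1) ^ m * (-1) ^ m) * (S * (ι Q (a 0) * ι Q (b 0))) := by
            rw [ca]; simp only [mul_assoc]
        _ = _ := by rw [nn, one_mul]
    rw [rt, rs]
    refine ⟨?_, ?_, ?_, ?_⟩
    · calc s * t = ι Q (a 0) * (S * (ι Q (a 0) * ι Q (b 0))) * T := by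
            rw [hs, ht]; simp only [mul_assoc]
        _ = (ι Q (a 0) * ι Q (a 0)) * ι Q (b 0) * (S * T) := by
            rw [cab]; simp only [mul_assoc]
        _ = (ι Q (b 0) * reverse T) * S := by rw [aa, i1, one_mul, mul_assoc]
        _ = reverse T * (ι Q (b 0) * (ι Q (a 0) * ι Q (a 0))) * S := by rw [drb, aa, mul_one]
        _ = _ := by rw [hs]; simp only [mul_assoc]
    · calc _ = reverse S * (ι Q (a 0) * ι Q (a 0)) * S := by rw [hs]; simp only [mul_assoc]
        _ = 1 := by rw [aa, mul_one, i2]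
    · calc s ^ 2 = (ι Q (a 0) * S) * ι Q (a 0) * S := by rw [hs, sq]; simp only [mul_assoc]
        _ = (-1) ^ m * (S * (ι Q (a 0) * ι Q (a 0)) * S) := by rw [ca]; simp only [mul_assoc]
        _ = (-1) ^ m * S ^ 2 := by rw [aa, mul_one, sq]
        _ = _ := by rw [i3, ← pow_add, Nat.triangle_succ, add_comm]
    · calc _ = reverse T * (ι Q (b 0) * (ι Q (a 0) * ι Q (a 0)) * ι Q (b 0)) * T := by
            rw [ht]; simp only [mul_assoc]
        _ = algebraMap F _ (α 0) * (reverse T * T) := by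
            rw [aa, mul_one, bb, ← Algebra.commutes, mul_assoc]
        _ = _ := by rw [i4, Fin.prod_univ_succ, map_mul]

/-- For a system of hyperbolic pairs `eᵢ, fᵢ`, the element
`t = β·∏ ι(eᵢ+fᵢ)·ι(eᵢ+αᵢfᵢ)` is conjugated by `s = ∏ ι(eᵢ+fᵢ)` to `N(t)·t⁻¹`
(i.e. `s·t = reverse(t)·s`), with `N(s) = reverse(s)·s = 1`, `s² = (−1)^{m(m−1)/2}`,
and `N(t) = reverse(t)·t = β²·∏ αᵢ`. -/
theorem stmt3 {F V : Type*} [Field F] [AddCommGroup V] [Module F V] [FiniteDimensional F V]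
    (hF2 : (2 : F) ≠ 0) (Q : QuadraticForm F V)
    (m : ℕ) (e f : Fin m → V)
    (he : ∀ i, Q (e i) = 0) (hf : ∀ i, Q (f i) = 0)
    (hef : ∀ i j, QuadraticMap.polar Q (e i) (f j) = if i = j then 1 else 0)
    (hee : ∀ i j, QuadraticMap.polar Q (e i) (e j) = 0)
    (hff : ∀ i j, QuadraticMap.polar Q (f i) (f j) = 0)
    (β : F) (hβ : β ≠ 0) (α : Fin m → F) (hα : ∀ i, α i ≠ 0)
    (t s : CliffordAlgebra Q)
    (ht : t = β • (List.ofFn fun i => ι Q (e i + f i) * ι Q (e i + α i • f i)).prod)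
    (hs : s = (List.ofFn fun i => ι Q (e i + f i)).prod) :
    s * t = reverse t * s ∧
    reverse s * s = 1 ∧
    s ^ 2 = (-1 : CliffordAlgebra Q) ^ (m * (m - 1) / 2) ∧
    reverse t * t = algebraMap F (CliffordAlgebra Q) (β ^ 2 * ∏ i, α i) := by
  have hfe : ∀ i j, QuadraticMap.polar Q (f i) (e j) = if i = j then 1 else 0 := fun i j => by
    rw [QuadraticMap.polar_comm, hef]; simp only [eq_comm]
  have hQ : ∀ i (c : F), Q (e i + c • f i) = c := fun i c => by
    rw [QuadraticMap.map_add Q, QuadraticMap.map_smul, QuadraticMap.polar_smul_right, he, hf, hef]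
    simp
  have hP : ∀ i j (c d : F), i ≠ j →
      QuadraticMap.polar Q (e i + c • f i) (e j + d • f j) = 0 := fun i j c d h => by
    simp [QuadraticMap.polar_add_left, QuadraticMap.polar_add_right,
      QuadraticMap.polar_smul_left, QuadraticMap.polar_smul_right, hef, hfe, hee, hff, h]
  have h1 : ∀ i, e i + f i = e i + (1 : F) • f i := fun i => by rw [one_smul]
  obtain ⟨i1, i2, i3, i4⟩ := stmt3_aux Q m (fun i => e i + f i) (fun i => e i + α i • f i) α
    (fun i => by rw [h1]; exact hQ i 1) (fun i => hQ i _)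
    (fun i j h => by rw [h1, h1]; exact hP i j 1 1 h)
    (fun i j h => by rw [h1]; exact hP i j 1 _ h)
    (fun i j h => hP i j _ _ h) _ s rfl hs
  refine ⟨?_, i2, i3, ?_⟩
  · rw [ht, mul_smul_comm, i1, map_smul, smul_mul_assoc]
  · rw [ht, map_smul, smul_mul_smul_comm, i4, map_mul, ← Algebra.smul_def, sq]
end

section
/- Let m ≥ 1 and let e₁, f₁, …, e_m, f_m ∈ V satisfy q(e_i) = q(f_i) = 0, B(e_i, f_j) = δ_{ij}, and B(e_i, e_j) = 0 = B(f_i, f_j) for all i, j. Let β, α₂, …, α_m ∈ F be nonzero and set t = β · ι(e₁+f₁)·ι(e₁−f₁) · ∏_{i=2}^m ι(e_i+f_i)·ι(e_i+α_i f_i) and s = ∏_{i=2}^m ι(e_i+f_i) in C(V,q). Then s·t = −reverse(t)·s, reverse(s)·s = 1, and s² = (−1)^{(m−1)(m−2)/2}. (Thus s conjugates t to −N(t)·t⁻¹ and N(s) = 1.) -/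
open CliffordAlgebra

section helpers
variable {F V : Type*} [Field F] [AddCommGroup V] [Module F V] {Q : QuadraticForm F V}

theorem aux_anti {x y : V} (h : QuadraticMap.polar Q x y = 0) :
    ι Q x * ι Q y = -(ι Q y * ι Q x) := by
  have := ι_mul_ι_add_swap (Q := Q) x y
  rw [h, map_zero] at this
  exact eq_neg_of_add_eq_zero_left this

theorem aux_swap (m : ℕ) (a : Fin m → V) (v : V)
    (h : ∀ i, QuadraticMap.polar Q (a i) v = 0) :
    (List.ofFn fun i => ι Q (a i)).prod * ι Q v
      = (-1) ^ m * (ι Q v * (List.ofFn fun i => ι Q (a i)).prod) := by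
  induction m with
  | zero => simp
  | succ n ih =>
    rw [List.ofFn_succ, List.prod_cons, mul_assoc, ih (fun i => a i.succ) (fun i => h _)]
    have hc : Commute ((-1 : CliffordAlgebra Q) ^ n) (ι Q (a 0)) :=
      (Commute.neg_one_left _).pow_left n
    rw [← mul_assoc, ← hc.eq, mul_assoc, ← mul_assoc (ι Q (a 0)), aux_anti (h 0), pow_succ]
    simp [mul_assoc]

theorem aux_comm2 {x u v : CliffordAlgebra Q} {n : ℕ}
    (hu : x * u = (-1) ^ n * (u * x)) (hv : x * v = (-1) ^ n * (v * x)) :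
    Commute x (u * v) := by
  have hc : Commute ((-1 : CliffordAlgebra Q) ^ n) u :=
    (Commute.neg_one_left _).pow_left n
  have h1 : (-1 : CliffordAlgebra Q) ^ n * (-1) ^ n = 1 := by
    rw [← (Commute.refl _).mul_pow]; simp
  change x * (u * v) = u * v * x
  calc x * (u * v) = (-1) ^ n * (u * (x * v)) := by rw [← mul_assoc, hu]; simp only [mul_assoc]
    _ = (-1) ^ n * ((u * (-1) ^ n) * (v * x)) := by rw [hv]; simp only [mul_assoc]
    _ = ((-1) ^ n * (-1) ^ n) * (u * (v * x)) := by rw [← hc.eq]; simp only [mul_assoc]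
    _ = _ := by rw [h1, one_mul, mul_assoc]

theorem aux_commV {x u v : V} (hu : QuadraticMap.polar Q x u = 0)
    (hv : QuadraticMap.polar Q x v = 0) : Commute (ι Q x) (ι Q u * ι Q v) := by
  apply aux_comm2 (n := 1) <;> simp [aux_anti, hu, hv]

theorem aux_commP (m : ℕ) (a b : Fin m → V) (x : V)
    (ha : ∀ i, QuadraticMap.polar Q x (a i) = 0) (hb : ∀ i, QuadraticMap.polar Q x (b i) = 0) :
    Commute (ι Q x) (reverse (List.ofFn fun i => ι Q (a i) * ι Q (b i)).prod) := by
  induction m with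
  | zero => simp
  | succ n ih =>
    rw [List.ofFn_succ, List.prod_cons, reverse.map_mul, reverse.map_mul, reverse_ι, reverse_ι]
    exact (ih (fun i => a i.succ) (fun i => b i.succ) (fun i => ha _) (fun i => hb _)).mul_right
      (aux_commV (hb 0) (ha 0))

theorem aux_sq {x : V} (h : Q x = 1) : ι Q x * ι Q x = 1 := by
  rw [ι_sq_scalar, h, map_one]

theorem aux_main (m : ℕ) (a b : Fin m → V) (hq : ∀ i, Q (a i) = 1)
    (haa : ∀ i j, i ≠ j → QuadraticMap.polar Q (a i) (a j) = 0)
    (hab : ∀ i j, i ≠ j → QuadraticMap.polar Q (a i) (b j) = 0)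
    (hbb : ∀ i j, i ≠ j → QuadraticMap.polar Q (b i) (b j) = 0) :
    (List.ofFn fun i => ι Q (a i)).prod * (List.ofFn fun i => ι Q (a i) * ι Q (b i)).prod
      = reverse (List.ofFn fun i => ι Q (a i) * ι Q (b i)).prod
        * (List.ofFn fun i => ι Q (a i)).prod := by
  induction m with
  | zero => simp
  | succ n ih =>
    have ih' := ih (fun i => a i.succ) (fun i => b i.succ) (fun i => hq _)
      (fun i j h => haa _ _ (by simpa using h)) (fun i j h => hab _ _ (by simpa using h))
      (fun i j h => hbb _ _ (by simpa using h))
    have c1 := aux_comm2 (aux_swap n (fun i => a i.succ) (a 0) (fun i => haa _ _ (by simp)))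
      (aux_swap n (fun i => a i.succ) (b 0) (fun i => hab _ _ (by simp)))
    have c2 := aux_commP n (fun i => a i.succ) (fun i => b i.succ) (a 0)
      (fun i => haa _ _ (by simp [eq_comm])) (fun i => hab _ _ (by simp [eq_comm]))
    have hs := aux_sq (hq 0)
    rw [List.ofFn_succ, List.prod_cons, List.ofFn_succ, List.prod_cons, reverse.map_mul,
      reverse.map_mul, reverse_ι, reverse_ι]
    set s := (List.ofFn fun i : Fin n => ι Q (a i.succ)).prod
    set P := (List.ofFn fun i : Fin n => ι Q (a i.succ) * ι Q (b i.succ)).prod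
    have c3 := aux_commP n (fun i => a i.succ) (fun i => b i.succ) (b 0)
      (fun i => by rw [QuadraticMap.polar_comm]; exact hab _ _ (by simp))
      (fun i => hbb _ _ (by simp [eq_comm]))
    calc ι Q (a 0) * s * (ι Q (a 0) * ι Q (b 0) * P)
        = ι Q (a 0) * (s * (ι Q (a 0) * ι Q (b 0))) * P := by simp only [mul_assoc]
      _ = (ι Q (a 0) * ι Q (a 0)) * ι Q (b 0) * (s * P) := by rw [c1.eq]; simp only [mul_assoc]
      _ = ι Q (b 0) * reverse P * s := by rw [hs, ih', one_mul, mul_assoc]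
      _ = reverse P * ι Q (b 0) * (ι Q (a 0) * ι Q (a 0)) * s := by rw [c3.eq, hs, mul_one]
      _ = _ := by simp only [mul_assoc]

theorem aux_norm (m : ℕ) (a : Fin m → V) (hq : ∀ i, Q (a i) = 1) :
    reverse (List.ofFn fun i => ι Q (a i)).prod * (List.ofFn fun i => ι Q (a i)).prod = 1 := by
  induction m with
  | zero => simp
  | succ n ih =>
    rw [List.ofFn_succ, List.prod_cons, reverse.map_mul, reverse_ι, mul_assoc,
      ← mul_assoc (ι Q (a 0)), aux_sq (hq 0), one_mul, ih (fun i => a i.succ) (fun i => hq _)]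

theorem aux_square (m : ℕ) (a : Fin m → V) (hq : ∀ i, Q (a i) = 1)
    (haa : ∀ i j, i ≠ j → QuadraticMap.polar Q (a i) (a j) = 0) :
    (List.ofFn fun i => ι Q (a i)).prod ^ 2 = (-1) ^ (m * (m - 1) / 2) := by
  induction m with
  | zero => simp
  | succ n ih =>
    have ih' := ih (fun i => a i.succ) (fun i => hq _)
      (fun i j h => haa _ _ (by simpa using h))
    have c1 := aux_swap n (fun i => a i.succ) (a 0) (fun i => haa _ _ (by simp))
    have hs := aux_sq (hq 0)
    have hc : Commute ((-1 : CliffordAlgebra Q) ^ n) (ι Q (a 0)) :=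
      (Commute.neg_one_left _).pow_left n
    have hn : (n + 1) * (n + 1 - 1) / 2 = n + n * (n - 1) / 2 := by
      rw [← Finset.sum_range_id_mul_two n, Nat.mul_div_cancel _ two_pos,
        ← Finset.sum_range_id_mul_two (n + 1), Nat.mul_div_cancel _ two_pos,
        Finset.sum_range_succ, add_comm]
    rw [hn, pow_add, ← ih', List.ofFn_succ, List.prod_cons]
    set s := (List.ofFn fun i : Fin n => ι Q (a i.succ)).prod
    calc (ι Q (a 0) * s) ^ 2 = ι Q (a 0) * (s * ι Q (a 0)) * s := by
          rw [pow_two]; simp only [mul_assoc]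
      _ = (ι Q (a 0) * (-1) ^ n) * (ι Q (a 0) * (s * s)) := by rw [c1]; simp only [mul_assoc]
      _ = (-1) ^ n * ((ι Q (a 0) * ι Q (a 0)) * (s * s)) := by
          rw [← hc.eq]; simp only [mul_assoc]
      _ = _ := by rw [hs, one_mul, pow_two]

end helpers

/-- (Here the number of hyperbolic pairs is `m + 1 ≥ 1`, matching the
paper's `m ≥ 1`; the pairs are indexed by `Fin (m+1)`, the first pair giving the factor
`ι(e₁+f₁)·ι(e₁−f₁)` and the remaining `m` pairs the factors `ι(eᵢ+fᵢ)·ι(eᵢ+αᵢfᵢ)`.)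
For `t = β·ι(e₀+f₀)·ι(e₀−f₀)·∏_{i=1}^{m} ι(eᵢ+fᵢ)·ι(eᵢ+αᵢfᵢ)` and
`s = ∏_{i=1}^{m} ι(eᵢ+fᵢ)` one has `s·t = −reverse(t)·s`, `reverse(s)·s = 1`, and
`s² = (−1)^{m(m−1)/2}` (which is `(−1)^{(M−1)(M−2)/2}` for `M = m+1` pairs). -/
theorem stmt4 {F V : Type*} [Field F] [AddCommGroup V] [Module F V] [FiniteDimensional F V]
    (hF2 : (2 : F) ≠ 0) (Q : QuadraticForm F V)
    (m : ℕ) (e f : Fin (m + 1) → V)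
    (he : ∀ i, Q (e i) = 0) (hf : ∀ i, Q (f i) = 0)
    (hef : ∀ i j, QuadraticMap.polar Q (e i) (f j) = if i = j then 1 else 0)
    (hee : ∀ i j, QuadraticMap.polar Q (e i) (e j) = 0)
    (hff : ∀ i j, QuadraticMap.polar Q (f i) (f j) = 0)
    (β : F) (hβ : β ≠ 0) (α : Fin m → F) (hα : ∀ i, α i ≠ 0)
    (t s : CliffordAlgebra Q)
    (ht : t = β • (ι Q (e 0 + f 0) * ι Q (e 0 - f 0) *
      (List.ofFn fun i : Fin m =>
        ι Q (e i.succ + f i.succ) * ι Q (e i.succ + α i • f i.succ)).prod))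
    (hs : s = (List.ofFn fun i : Fin m => ι Q (e i.succ + f i.succ)).prod) :
    s * t = -(reverse t * s) ∧
    reverse s * s = 1 ∧
    s ^ 2 = (-1 : CliffordAlgebra Q) ^ (m * (m - 1) / 2) := by
  have key : ∀ (i j) (x y : F), i ≠ j →
      QuadraticMap.polar Q (e i + x • f i) (e j + y • f j) = 0 := by
    intro i j x y h
    simp [QuadraticMap.polar_add_left, QuadraticMap.polar_add_right, hee, hff, hef, h,
      QuadraticMap.polar_comm Q (f i) (e j), h.symm]
  have k1 : ∀ i, e i + f i = e i + (1 : F) • f i := fun i => by simp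
  have k2 : e 0 - f 0 = e 0 + (-1 : F) • f 0 := by simp [sub_eq_add_neg]
  have hq : ∀ i, Q (e i + f i) = 1 := by
    intro i
    rw [QuadraticMap.map_add Q, he, hf, hef]; simp
  have h0 : QuadraticMap.polar Q (e 0 + f 0) (e 0 - f 0) = 0 := by
    rw [k2]
    simp [QuadraticMap.polar_add_left, QuadraticMap.polar_add_right, hee, hff, hef,
      QuadraticMap.polar_comm Q (f 0) (e 0)]
  have hne : ∀ i j : Fin m, i ≠ j → i.succ ≠ j.succ := fun i j h => by simpa using h
  have haa : ∀ i j : Fin m, i ≠ j →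
      QuadraticMap.polar Q (e i.succ + f i.succ) (e j.succ + f j.succ) = 0 := by
    intro i j h
    rw [k1, k1]; exact key _ _ _ _ (hne i j h)
  refine ⟨?_, ?_, ?_⟩
  · have hm := aux_main (Q := Q) m (fun i => e i.succ + f i.succ)
      (fun i => e i.succ + α i • f i.succ) (fun i => hq _) haa
      (fun i j h => by rw [k1]; exact key _ _ _ _ (hne i j h))
      (fun i j h => key _ _ _ _ (hne i j h))
    have c1 := aux_comm2 (aux_swap (Q := Q) m (fun i => e i.succ + f i.succ) (e 0 + f 0)
        (fun i => by rw [k1, k1]; exact key _ _ _ _ (by simp)))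
      (aux_swap m (fun i => e i.succ + f i.succ) (e 0 - f 0)
        (fun i => by rw [k1, k2]; exact key _ _ _ _ (by simp)))
    have c2 := aux_commP (Q := Q) m (fun i => e i.succ + f i.succ)
      (fun i => e i.succ + α i • f i.succ) (e 0 + f 0)
      (fun i => by rw [k1, k1]; exact key _ _ _ _ (by simp [eq_comm]))
      (fun i => by rw [k1]; exact key _ _ _ _ (by simp [eq_comm]))
    have c3 := aux_commP (Q := Q) m (fun i => e i.succ + f i.succ)
      (fun i => e i.succ + α i • f i.succ) (e 0 - f 0)
      (fun i => by rw [k1, k2]; exact key _ _ _ _ (by simp [eq_comm]))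
      (fun i => by rw [k2]; exact key _ _ _ _ (by simp [eq_comm]))
    have c4 := c2.mul_left c3
    have h0' := aux_anti h0
    rw [← hs] at hm c1
    rw [ht, map_smul, reverse.map_mul, reverse.map_mul, reverse_ι, reverse_ι,
      mul_smul_comm, smul_mul_assoc, ← smul_neg]
    congr 1
    rw [← mul_assoc, c1.eq, mul_assoc, hm, ← mul_assoc, c4.eq, h0']
    simp
  · rw [hs]; exact aux_norm m _ (fun i => hq _)
  · rw [hs]; exact aux_square m _ (fun i => hq _) haa
end

section
/- Let V₁ and V₂ be subspaces of V with B(x,y) = 0 for all x ∈ V₁ and y ∈ V₂. Let t₁, s₁ lie in the subalgebra of C(V,q) generated by ι(V₁), let t₂, s₂ lie in the subalgebra generated by ι(V₂), and suppose t₁ and t₂ lie in the even part C₀(V,q). If s₁·t₁ = reverse(t₁)·s₁ and s₂·t₂ = reverse(t₂)·s₂, then (s₁s₂)·(t₁t₂) = reverse(t₁t₂)·(s₁s₂). (That is: if each s_i conjugates t_i to N(t_i)·t_i⁻¹ on its factor, then s₁s₂ conjugates t₁t₂ to N(t₁t₂)·(t₁t₂)⁻¹.) -/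
open CliffordAlgebra

/-- Vectors orthogonal to `W` commute with elements of the algebra generated by `W`,
up to the grade involution. -/
theorem stmt6_aux {F V : Type*} [Field F] [AddCommGroup V] [Module F V]
    (Q : QuadraticForm F V) (W : Submodule F V) (v : V)
    (h : ∀ x ∈ W, QuadraticMap.polar Q v x = 0) (t : CliffordAlgebra Q)
    (ht : t ∈ Algebra.adjoin F (⇑(ι Q) '' (W : Set V))) :
    ι Q v * t = involute t * ι Q v := by
  induction ht using Algebra.adjoin_induction with
  | mem x hx =>
    obtain ⟨w, hw, rfl⟩ := hx
    have h1 := ι_mul_ι_add_swap (Q := Q) v w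
    rw [h w hw, map_zero] at h1
    rw [involute_ι, neg_mul]
    exact eq_neg_of_add_eq_zero_left h1
  | algebraMap r => rw [AlgHom.commutes, Algebra.commutes]
  | add x y _ _ hx hy => rw [mul_add, hx, hy, map_add, add_mul]
  | mul x y _ _ hx hy => rw [← mul_assoc, hx, mul_assoc, hy, map_mul, mul_assoc]

/-- An even element of the algebra generated by `W`, and its reversal, commute with the algebra
generated by a subspace orthogonal to `W`. -/
theorem stmt6_comm {F V : Type*} [Field F] [AddCommGroup V] [Module F V]
    (Q : QuadraticForm F V) (W U : Submodule F V)
    (h : ∀ v ∈ U, ∀ x ∈ W, QuadraticMap.polar Q v x = 0) (t s : CliffordAlgebra Q)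
    (ht : t ∈ Algebra.adjoin F (⇑(ι Q) '' (W : Set V))) (hte : t ∈ evenOdd Q 0)
    (hs : s ∈ Algebra.adjoin F (⇑(ι Q) '' (U : Set V))) :
    s * t = t * s ∧ s * reverse t = reverse t * s := by
  induction hs using Algebra.adjoin_induction with
  | mem x hx =>
    obtain ⟨v, hv, rfl⟩ := hx
    have h1 := stmt6_aux Q W v (h v hv) t ht
    rw [involute_eq_of_mem_even hte] at h1
    refine ⟨h1, ?_⟩
    have h2 := congrArg reverse h1
    rw [reverse.map_mul, reverse.map_mul, reverse_ι] at h2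
    exact h2.symm
  | algebraMap r => exact ⟨Algebra.commutes _ _, Algebra.commutes _ _⟩
  | add x y _ _ hx hy =>
    exact ⟨by rw [add_mul, mul_add, hx.1, hy.1], by rw [add_mul, mul_add, hx.2, hy.2]⟩
  | mul x y _ _ hx hy =>
    exact ⟨by rw [mul_assoc, hy.1, ← mul_assoc, hx.1, mul_assoc],
      by rw [mul_assoc, hy.2, ← mul_assoc, hx.2, mul_assoc]⟩

/-- If `V₁ ⊥ V₂`, `tᵢ, sᵢ` lie in the subalgebra generated by `ι(Vᵢ)`,
the `tᵢ` are even, and each `sᵢ` conjugates `tᵢ` to `N(tᵢ)·tᵢ⁻¹` (i.e.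
`sᵢ·tᵢ = reverse(tᵢ)·sᵢ`), then `s₁s₂` conjugates `t₁t₂` to `N(t₁t₂)·(t₁t₂)⁻¹`. -/
theorem stmt6 {F V : Type*} [Field F] [AddCommGroup V] [Module F V] [FiniteDimensional F V]
    (hF2 : (2 : F) ≠ 0) (Q : QuadraticForm F V)
    (V₁ V₂ : Submodule F V)
    (horth : ∀ x ∈ V₁, ∀ y ∈ V₂, QuadraticMap.polar Q x y = 0)
    (t₁ s₁ t₂ s₂ : CliffordAlgebra Q)
    (ht₁ : t₁ ∈ Algebra.adjoin F (⇑(ι Q) '' (V₁ : Set V)))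
    (hs₁ : s₁ ∈ Algebra.adjoin F (⇑(ι Q) '' (V₁ : Set V)))
    (ht₂ : t₂ ∈ Algebra.adjoin F (⇑(ι Q) '' (V₂ : Set V)))
    (hs₂ : s₂ ∈ Algebra.adjoin F (⇑(ι Q) '' (V₂ : Set V)))
    (ht₁e : t₁ ∈ evenOdd Q 0) (ht₂e : t₂ ∈ evenOdd Q 0)
    (h₁ : s₁ * t₁ = reverse t₁ * s₁) (h₂ : s₂ * t₂ = reverse t₂ * s₂) :
    (s₁ * s₂) * (t₁ * t₂) = reverse (t₁ * t₂) * (s₁ * s₂) := by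
  have horth' : ∀ v ∈ V₂, ∀ x ∈ V₁, QuadraticMap.polar Q v x = 0 := fun v hv x hx => by
    rw [QuadraticMap.polar_comm]; exact horth x hx v hv
  have c1 := (stmt6_comm Q V₁ V₂ horth' t₁ s₂ ht₁ ht₁e hs₂).1
  have c2 := (stmt6_comm Q V₂ V₁ horth t₂ s₁ ht₂ ht₂e hs₁).2
  have c3 := congrArg reverse (stmt6_comm Q V₂ V₁ horth t₂ t₁ ht₂ ht₂e ht₁).1
  rw [reverse.map_mul t₂ t₁] at c3
  calc (s₁ * s₂) * (t₁ * t₂) = s₁ * (s₂ * t₁) * t₂ := by simp only [mul_assoc]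
    _ = (s₁ * t₁) * (s₂ * t₂) := by rw [c1]; simp only [mul_assoc]
    _ = reverse t₁ * (s₁ * reverse t₂) * s₂ := by rw [h₁, h₂]; simp only [mul_assoc]
    _ = (reverse t₁ * reverse t₂) * (s₁ * s₂) := by rw [c2]; simp only [mul_assoc]
    _ = reverse (t₁ * t₂) * (s₁ * s₂) := by rw [c3]
end

section
/- Let F be a field of characteristic ≠ 2, q a nondegenerate quadratic form on V, and dim V = 2m with m odd. Let f : V → V be a linear automorphism with q(f(v)) = q(v) for all v ∈ V and det f = 1 (i.e. f ∈ SO(q)), and suppose f is a semisimple endomorphism of V. Then there exists a linear automorphism g of V with q(g(v)) = q(v) for all v, det g = 1, and g ∘ f ∘ g⁻¹ = f⁻¹, if and only if there exists v ∈ V, v ≠ 0, with f(v) = v or f(v) = −v (that is, f is real in SO(q) if and only if 1 or −1 is an eigenvalue of f). -/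
/-- Hyperbolic families of any size `k ≤ m` in an alternating nondegenerate space of dimension `2m`. -/
theorem exists_hyp_family {F V : Type*} [Field F] [AddCommGroup V] [Module F V]
    [FiniteDimensional F V] (w : LinearMap.BilinForm F V) (halt : ∀ x, w x x = 0)
    (hnd : ∀ x, (∀ y, w x y = 0) → x = 0) (m : ℕ) (hdim : Module.finrank F V = 2 * m) :
    ∀ k : ℕ, k ≤ m → ∃ x y : Fin k → V, (∀ i j, w (x i) (x j) = 0) ∧ (∀ i j, w (y i) (y j) = 0) ∧
      (∀ i j, w (x i) (y j) = if i = j then 1 else 0) := by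
  have hsk : ∀ a b, w a b = - w b a := by
    intro a b
    have h := halt (a + b)
    simp only [map_add, LinearMap.add_apply, halt, zero_add, add_zero] at h
    exact eq_neg_of_add_eq_zero_right h
  intro k
  induction k with
  | zero => intro _; exact ⟨Fin.elim0, Fin.elim0, fun i => i.elim0, fun i => i.elim0, fun i => i.elim0⟩
  | succ k ih =>
    intro hk
    obtain ⟨x, y, hx, hy, hxy⟩ := ih (by omega)
    have hyx : ∀ i j, w (y i) (x j) = if i = j then -1 else 0 := by
      intro i j
      rw [hsk, hxy]
      by_cases h : i = j
      · simp [h]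
      · simp [h, Ne.symm h]
    let φ : V →ₗ[F] (Fin k → F) × (Fin k → F) :=
      (LinearMap.pi fun i => w (x i)).prod (LinearMap.pi fun i => w (y i))
    have hker : LinearMap.ker φ ≠ ⊥ := by
      apply LinearMap.ker_ne_bot_of_finrank_lt
      simp [hdim]
      omega
    obtain ⟨z, hz, hz0⟩ := Submodule.exists_mem_ne_zero_of_ne_bot hker
    have hz' : (∀ i, w (x i) z = 0) ∧ (∀ i, w (y i) z = 0) := by
      have : φ z = 0 := hz
      exact ⟨fun i => congrFun (congrArg Prod.fst this) i,
        fun i => congrFun (congrArg Prod.snd this) i⟩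
    obtain ⟨u, hu⟩ : ∃ u, w z u ≠ 0 := by
      by_contra! h
      exact hz0 (hnd z h)
    let u0 := (w z u)⁻¹ • u
    have hu0 : w z u0 = 1 := by simp [u0, hu]
    let t := u0 - ∑ i, w (x i) u0 • y i + ∑ i, w (y i) u0 • x i
    have hzx : ∀ i, w z (x i) = 0 := fun i => by rw [hsk, hz'.1, neg_zero]
    have hzy : ∀ i, w z (y i) = 0 := fun i => by rw [hsk, hz'.2, neg_zero]
    have hzt : w z t = 1 := by simp [t, hu0, hzx, hzy]
    have hxt : ∀ i, w (x i) t = 0 := fun i => by simp [t, hx, hxy]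
    have hyt : ∀ i, w (y i) t = 0 := fun i => by simp [t, hy, hyx]
    have htx : ∀ i, w t (x i) = 0 := fun i => by rw [hsk, hxt, neg_zero]
    have hty : ∀ i, w t (y i) = 0 := fun i => by rw [hsk, hyt, neg_zero]
    refine ⟨Fin.cons z x, Fin.cons t y, ?_, ?_, ?_⟩
    · intro i j
      refine Fin.cases ?_ (fun i => ?_) i <;> refine Fin.cases ?_ (fun j => ?_) j <;>
        simp [halt, hx, hzx, hz'.1]
    · intro i j
      refine Fin.cases ?_ (fun i => ?_) i <;> refine Fin.cases ?_ (fun j => ?_) j <;>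
        simp [halt, hy, hyt, hty]
    · intro i j
      refine Fin.cases ?_ (fun i => ?_) i <;> refine Fin.cases ?_ (fun j => ?_) j <;>
        simp [hzt, hzy, hxt, hxy, Fin.succ_ne_zero, (Fin.succ_ne_zero _).symm]

/-- An anti-symplectic map of a `2m`-dimensional space has determinant `(-1)^m`. -/
theorem det_antisymp {F V : Type*} [Field F] [AddCommGroup V] [Module F V]
    [FiniteDimensional F V] (w : LinearMap.BilinForm F V) (halt : ∀ x, w x x = 0)
    (hnd : ∀ x, (∀ y, w x y = 0) → x = 0) (m : ℕ) (hm : 0 < m)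
    (hdim : Module.finrank F V = 2 * m) (g : V →ₗ[F] V) (hg : ∀ x y, w (g x) (g y) = - w x y) :
    LinearMap.det g = (-1) ^ m := by
  have hsk : ∀ a b, w a b = - w b a := by
    intro a b
    have h := halt (a + b)
    simp only [map_add, LinearMap.add_apply, halt, zero_add, add_zero] at h
    exact eq_neg_of_add_eq_zero_right h
  obtain ⟨x, y, hx, hy, hxy⟩ := exists_hyp_family w halt hnd m hdim m le_rfl
  have hyx : ∀ i j, w (y i) (x j) = if i = j then -1 else 0 := by
    intro i j
    rw [hsk, hxy]
    by_cases h : i = j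
    · simp [h]
    · simp [h, Ne.symm h]
  let v : Fin m ⊕ Fin m → V := Sum.elim y x
  have hli : LinearIndependent F v := by
    rw [Fintype.linearIndependent_iff]
    intro c hc
    rw [Fintype.sum_sum_type] at hc
    simp only [v, Sum.elim_inl, Sum.elim_inr] at hc
    rintro (i | i)
    · have := congrArg (w (x i)) hc
      simpa [hx, hxy] using this
    · have := congrArg (w (y i)) hc
      simpa [hy, hyx] using this
  have : Nonempty (Fin m ⊕ Fin m) := ⟨Sum.inl ⟨0, hm⟩⟩
  let b := basisOfLinearIndependentOfCardEqFinrank hli (by simp [hdim]; omega)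
  have hb : ∀ i, b i = v i := fun i => by simp [b]
  have hJ : LinearMap.BilinForm.toMatrix b w = Matrix.J (Fin m) F := by
    ext i j
    rw [LinearMap.BilinForm.toMatrix_apply, hb, hb]
    rcases i with i | i <;> rcases j with j | j <;>
      simp [v, Matrix.J, hx, hy, hxy, hyx, Matrix.one_apply]
    split_ifs <;> simp
  have hcomp : w.comp g g = (-1 : F) • w := by
    ext a c
    simp [hg]
  have hM := LinearMap.BilinForm.toMatrix_comp b b w g g
  rw [hcomp, map_smul, neg_one_smul, hJ] at hM
  set M := LinearMap.toMatrix b b g with hMdef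
  let S : Matrix (Fin m ⊕ Fin m) (Fin m ⊕ Fin m) F := Matrix.fromBlocks 1 0 0 (-1)
  have hS : S.transpose * Matrix.J (Fin m) F * S = - Matrix.J (Fin m) F := by
    simp [S, Matrix.J, Matrix.fromBlocks_transpose, Matrix.fromBlocks_multiply,
      Matrix.fromBlocks_neg]
  have hmem : S * M ∈ Matrix.symplecticGroup (Fin m) F := by
    rw [SymplecticGroup.mem_iff', Matrix.transpose_mul]
    calc _ = M.transpose * (S.transpose * Matrix.J (Fin m) F * S) * M := by
            simp only [Matrix.mul_assoc]
      _ = _ := by rw [hS, Matrix.mul_neg, Matrix.neg_mul, ← hM, neg_neg]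
  have hdet := SymplecticGroup.det_eq_one hmem
  rw [Matrix.det_mul, Matrix.det_fromBlocks_zero₁₂, hMdef, LinearMap.det_toMatrix] at hdet
  simp only [Matrix.det_one, one_mul, Matrix.det_neg, Fintype.card_fin, mul_one] at hdet
  calc LinearMap.det g = ((-1) ^ m * (-1) ^ m) * LinearMap.det g := by
        rw [← mul_pow]; simp
    _ = (-1) ^ m * ((-1) ^ m * LinearMap.det g) := by ring
    _ = _ := by rw [hdet, mul_one]

/-- Forward direction. -/
theorem stmt10_forward {F V : Type*} [Field F] [AddCommGroup V] [Module F V]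
    [FiniteDimensional F V] (B : LinearMap.BilinForm F V)
    (hsymm : ∀ x y, B x y = B y x) (hnd : ∀ x, (∀ y, B x y = 0) → x = 0)
    (m : ℕ) (hm : 0 < m) (hdim : Module.finrank F V = 2 * m)
    (f : V ≃ₗ[F] V) (hf : ∀ x y, B (f x) (f y) = B x y)
    (hev : ¬ ∃ v : V, v ≠ 0 ∧ (f v = v ∨ f v = -v))
    (g : V ≃ₗ[F] V) (hg : ∀ x y, B (g x) (g y) = B x y) (hgf : ∀ x, g (f x) = f.symm (g x)) :
    LinearMap.det (g : V →ₗ[F] V) = (-1) ^ m := by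
  have hf1 : ∀ x y, B (f x) y = B x (f.symm y) := fun x y => by
    rw [← hf x (f.symm y), f.apply_symm_apply]
  have hf2 : ∀ x y, B (f.symm x) y = B x (f y) := fun x y => by
    rw [hsymm, ← hf1, hsymm]
  have hgf' : ∀ x, g (f.symm x) = f (g x) := fun x => by
    have := hgf (f.symm x)
    rw [f.apply_symm_apply] at this
    rw [this, f.apply_symm_apply]
  let h : V →ₗ[F] V := (f : V →ₗ[F] V) - (f.symm : V →ₗ[F] V)
  have hh : ∀ x, h x = f x - f.symm x := fun x => rfl
  have hinj : ∀ x, h x = 0 → x = 0 := by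
    intro x hx
    rw [hh, sub_eq_zero] at hx
    have h2 : f (f x) = x := by rw [hx, f.apply_symm_apply]
    by_contra hx0
    by_cases h3 : f x + x = 0
    · exact hev ⟨x, hx0, Or.inr (eq_neg_of_add_eq_zero_left h3)⟩
    · exact hev ⟨f x + x, h3, Or.inl (by rw [map_add, h2, add_comm])⟩
  let w : LinearMap.BilinForm F V := B.comp h LinearMap.id
  have hw : ∀ x y, w x y = B (h x) y := fun x y => rfl
  refine det_antisymp w ?_ ?_ m hm hdim _ ?_
  · intro x
    have : B (f x) x = B (f.symm x) x := by rw [hf2, hsymm]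
    rw [hw, hh, map_sub, LinearMap.sub_apply, this, sub_self]
  · intro x hx
    exact hinj x (hnd _ hx)
  · intro x y
    have : h (g x) = - g (h x) := by
      rw [hh, hh, map_sub, hgf, hgf']; abel
    rw [hw, hw, LinearEquiv.coe_coe, this, map_neg, LinearMap.neg_apply, hg]

/-- `X` is nondegenerate for `B`. -/
def NDOn {F V : Type*} [Field F] [AddCommGroup V] [Module F V]
    (B : LinearMap.BilinForm F V) (X : Submodule F V) : Prop :=
  ∀ x ∈ X, (∀ y ∈ X, B x y = 0) → x = 0

/-- `X` is stable under `f`. -/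
def StableOn {F V : Type*} [Field F] [AddCommGroup V] [Module F V]
    (f : V ≃ₗ[F] V) (X : Submodule F V) : Prop :=
  ∀ x ∈ X, f x ∈ X

/-- `X` is stable, nondegenerate, and `f` is inverted by an isometry on `X`. -/
def GoodOn {F V : Type*} [Field F] [AddCommGroup V] [Module F V]
    (B : LinearMap.BilinForm F V) (f : V ≃ₗ[F] V) (X : Submodule F V) : Prop :=
  StableOn f X ∧ NDOn B X ∧ ∃ g : V →ₗ[F] V, (∀ x ∈ X, g x ∈ X) ∧
    (∀ x ∈ X, ∀ y ∈ X, B (g x) (g y) = B x y) ∧ ∀ x ∈ X, g (f x) = f.symm (g x)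

section
variable {F V : Type*} [Field F] [AddCommGroup V] [Module F V] [FiniteDimensional F V]

theorem StableOn.symm_mem {f : V ≃ₗ[F] V} {X : Submodule F V} (h : StableOn f X) :
    ∀ x ∈ X, f.symm x ∈ X := by
  have hle : X.map (f : V →ₗ[F] V) ≤ X := by
    rintro _ ⟨x, hx, rfl⟩
    exact h x hx
  have heq : X.map (f : V →ₗ[F] V) = X :=
    Submodule.eq_of_le_of_finrank_eq hle (LinearEquiv.finrank_map_eq f X)
  intro x hx
  rw [← heq] at hx
  obtain ⟨y, hy, rfl⟩ := hx
  simpa using hy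

theorem StableOn.zpow_mem {f : V ≃ₗ[F] V} {X : Submodule F V} (h : StableOn f X) (n : ℤ) :
    ∀ x ∈ X, (f ^ n) x ∈ X := by
  induction n using Int.induction_on with
  | zero => intro x hx; simpa using hx
  | succ n ih =>
    intro x hx
    rw [add_comm, zpow_add, zpow_one]
    exact h _ (ih x hx)
  | pred n ih =>
    intro x hx
    rw [sub_eq_add_neg, add_comm, zpow_add, zpow_neg_one]
    exact h.symm_mem _ (ih x hx)

theorem isometry_zpow {B : LinearMap.BilinForm F V} {f : V ≃ₗ[F] V}
    (hf : ∀ x y, B (f x) (f y) = B x y) (n : ℤ) : ∀ x y, B ((f ^ n) x) ((f ^ n) y) = B x y := by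
  induction n using Int.induction_on with
  | zero => intro x y; simp
  | succ n ih =>
    intro x y
    rw [add_comm, zpow_add, zpow_one]
    exact (hf _ _).trans (ih x y)
  | pred n ih =>
    intro x y
    rw [sub_eq_add_neg, add_comm, zpow_add, zpow_neg_one]
    rw [← ih x y, ← hf]
    change B (f (f.symm _)) (f (f.symm _)) = _
    rw [f.apply_symm_apply, f.apply_symm_apply]
    rfl

theorem gram_zpow {B : LinearMap.BilinForm F V} {f : V ≃ₗ[F] V}
    (hf : ∀ x y, B (f x) (f y) = B x y) (n k : ℤ) (x y : V) :
    B ((f ^ n) x) ((f ^ k) y) = B ((f ^ (-k)) x) ((f ^ (-n)) y) := by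
  rw [← isometry_zpow hf (n + k) ((f ^ (-k)) x)]
  rw [← LinearEquiv.mul_apply, ← LinearEquiv.mul_apply, ← zpow_add, ← zpow_add]
  congr 4 <;> ring_nf

theorem isCompl_orth {B : LinearMap.BilinForm F V} (hsymm : ∀ x y, B x y = B y x)
    {X : Submodule F V} (hX : NDOn B X) : IsCompl X (B.orthogonal X) := by
  have hr : B.IsRefl := fun x y h => by rw [hsymm, h]
  rw [LinearMap.BilinForm.isCompl_orthogonal_iff_disjoint hr, Submodule.disjoint_def]
  intro x hx hx'
  refine hX x hx fun y hy => ?_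
  rw [hsymm]
  exact hx' y hy

theorem exists_proj {B : LinearMap.BilinForm F V} (hsymm : ∀ x y, B x y = B y x)
    {X : Submodule F V} (hX : NDOn B X) :
    ∃ π : V →ₗ[F] V, (∀ x ∈ X, π x = x) ∧ (∀ v, (∀ x ∈ X, B x v = 0) → π v = 0) := by
  have hc := isCompl_orth hsymm hX
  refine ⟨LinearMap.ofIsCompl hc X.subtype 0, fun x hx => ?_, fun v hv => ?_⟩
  · exact LinearMap.ofIsCompl_apply_left hc ⟨x, hx⟩
  · exact LinearMap.ofIsCompl_apply_right hc (⟨v, hv⟩ : B.orthogonal X)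

theorem GoodOn.sup {B : LinearMap.BilinForm F V} {f : V ≃ₗ[F] V}
    (hsymm : ∀ x y, B x y = B y x) {X Y : Submodule F V}
    (hX : GoodOn B f X) (hY : GoodOn B f Y) (hXY : ∀ x ∈ X, ∀ y ∈ Y, B x y = 0) :
    GoodOn B f (X ⊔ Y) := by
  obtain ⟨sX, nX, gX, mX, iX, cX⟩ := hX
  obtain ⟨sY, nY, gY, mY, iY, cY⟩ := hY
  have hYX : ∀ y ∈ Y, ∀ x ∈ X, B y x = 0 := fun y hy x hx => by rw [hsymm, hXY x hx y hy]
  obtain ⟨πX, pX, pX'⟩ := exists_proj hsymm nX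
  obtain ⟨πY, pY, pY'⟩ := exists_proj hsymm nY
  let g : V →ₗ[F] V := gX ∘ₗ πX + gY ∘ₗ πY
  have hg : ∀ x ∈ X, ∀ y ∈ Y, g (x + y) = gX x + gY y := by
    intro x hx y hy
    have h1 : πX y = 0 := pX' y fun z hz => hXY z hz y hy
    have h2 : πY x = 0 := pY' x fun z hz => hYX z hz x hx
    simp [g, pX x hx, pY y hy, h1, h2]
  refine ⟨?_, ?_, g, ?_, ?_, ?_⟩
  · intro z hz
    obtain ⟨x, hx, y, hy, rfl⟩ := Submodule.mem_sup.1 hz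
    rw [map_add]
    exact Submodule.add_mem_sup (sX x hx) (sY y hy)
  · intro z hz h
    obtain ⟨x, hx, y, hy, rfl⟩ := Submodule.mem_sup.1 hz
    have hx0 : x = 0 := nX x hx fun x' hx' => by
      have := h x' (Submodule.mem_sup_left hx')
      simpa [hYX y hy x' hx'] using this
    have hy0 : y = 0 := nY y hy fun x' hx' => by
      have := h x' (Submodule.mem_sup_right hx')
      simpa [hXY x hx x' hx'] using this
    rw [hx0, hy0, add_zero]
  · intro z hz
    obtain ⟨x, hx, y, hy, rfl⟩ := Submodule.mem_sup.1 hz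
    rw [hg x hx y hy]
    exact Submodule.add_mem_sup (mX x hx) (mY y hy)
  · intro z hz z' hz'
    obtain ⟨x, hx, y, hy, rfl⟩ := Submodule.mem_sup.1 hz
    obtain ⟨x', hx', y', hy', rfl⟩ := Submodule.mem_sup.1 hz'
    rw [hg x hx y hy, hg x' hx' y' hy']
    simp [iX x hx x' hx', iY y hy y' hy', hXY x hx y' hy', hYX y hy x' hx',
      hXY _ (mX x hx) _ (mY y' hy'), hYX _ (mY y hy) _ (mX x' hx')]
  · intro z hz
    obtain ⟨x, hx, y, hy, rfl⟩ := Submodule.mem_sup.1 hz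
    rw [map_add, hg _ (sX x hx) _ (sY y hy), hg x hx y hy, cX x hx, cY y hy, map_add]

theorem goodOn_span {B : LinearMap.BilinForm F V} {f : V ≃ₗ[F] V} {ι : Type*} (a : ι → V)
    (s σ : Equiv.Perm ι) (hs : ∀ i, f (a i) = a (s i)) (hσs : ∀ i, σ (s i) = s.symm (σ i))
    (hgram : ∀ i j, B (a (σ i)) (a (σ j)) = B (a i) (a j))
    (hnd : NDOn B (Submodule.span F (Set.range a))) :
    GoodOn B f (Submodule.span F (Set.range a)) := by
  let S := Finsupp.linearCombination F a
  let T := Finsupp.linearCombination F (a ∘ σ)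
  have hSr : LinearMap.range S = Submodule.span F (Set.range a) :=
    Finsupp.range_linearCombination F
  have hTr : LinearMap.range T = Submodule.span F (Set.range a) := by
    rw [show LinearMap.range T = _ from Finsupp.range_linearCombination F,
      Set.range_comp, σ.surjective.range_eq, Set.image_univ]
  have hB : B.comp T T = B.comp S S := by
    ext i j
    simp [S, T, hgram]
  have hB' : ∀ c d, B (T c) (T d) = B (S c) (S d) := fun c d =>
    LinearMap.congr_fun (LinearMap.congr_fun hB c) d
  have hker : LinearMap.ker S ≤ LinearMap.ker T := by
    intro c hc
    have hc' : S c = 0 := hc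
    refine hnd _ (hTr ▸ LinearMap.mem_range_self T c) fun y hy => ?_
    rw [← hTr] at hy
    obtain ⟨d, rfl⟩ := hy
    rw [hB', hc', map_zero, LinearMap.zero_apply]
  obtain ⟨g, hg⟩ := LinearMap.exists_extend
    ((LinearMap.ker S).liftQ T hker ∘ₗ S.quotKerEquivRange.symm.toLinearMap)
  have hgS : ∀ c, g (S c) = T c := by
    intro c
    have h1 := LinearMap.congr_fun hg ⟨S c, LinearMap.mem_range_self S c⟩
    have h2 : S.quotKerEquivRange.symm ⟨S c, LinearMap.mem_range_self S c⟩
        = (LinearMap.ker S).mkQ c := by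
      rw [LinearEquiv.symm_apply_eq]
      rfl
    simp only [LinearMap.comp_apply, LinearEquiv.coe_coe, h2] at h1
    simpa using h1
  have hga : ∀ i, g (a i) = a (σ i) := by
    intro i
    have := hgS (Finsupp.single i 1)
    simpa [S, T] using this
  refine ⟨?_, hnd, g, ?_, ?_, ?_⟩
  · intro x hx
    have : Submodule.span F (Set.range a) ≤
        (Submodule.span F (Set.range a)).comap (f : V →ₗ[F] V) := by
      rw [Submodule.span_le]
      rintro _ ⟨i, rfl⟩
      change f (a i) ∈ Submodule.span F (Set.range a)
      rw [hs]
      exact Submodule.subset_span ⟨_, rfl⟩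
    exact this hx
  · intro x hx
    rw [← hSr] at hx
    obtain ⟨c, rfl⟩ := hx
    rw [hgS, ← hTr]
    exact LinearMap.mem_range_self T c
  · intro x hx y hy
    rw [← hSr] at hx hy
    obtain ⟨c, rfl⟩ := hx
    obtain ⟨d, rfl⟩ := hy
    rw [hgS, hgS, hB']
  · intro x hx
    induction hx using Submodule.span_induction with
    | mem x h =>
      obtain ⟨i, rfl⟩ := h
      rw [hs, hga, hga, hσs, LinearEquiv.eq_symm_apply, hs, s.apply_symm_apply]
    | zero => simp
    | add x y _ _ h1 h2 => simp [h1, h2]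
    | smul c x _ h => simp [h]

/-- Minimal nonzero stable subspace. -/
def MinStable (f : V ≃ₗ[F] V) (W : Submodule F V) : Prop :=
  StableOn f W ∧ W ≠ ⊥ ∧ ∀ W' ≤ W, StableOn f W' → W' ≠ ⊥ → W' = W

theorem exists_minStable {f : V ≃ₗ[F] V} {A : Submodule F V} (hA : StableOn f A) (h0 : A ≠ ⊥) :
    ∃ W ≤ A, MinStable f W := by
  obtain ⟨W, ⟨hWA, hWs, hW0⟩, hmin⟩ := (wellFounded_lt (α := Submodule F V)).has_min
    {W | W ≤ A ∧ StableOn f W ∧ W ≠ ⊥} ⟨A, le_rfl, hA, h0⟩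
  refine ⟨W, hWA, hWs, hW0, fun W' hle hs' h0' => ?_⟩
  by_contra hne
  exact hmin W' ⟨hle.trans hWA, hs', h0'⟩ (lt_of_le_of_ne hle hne)

theorem MinStable.exists_gen {f : V ≃ₗ[F] V} {W : Submodule F V} (hW : MinStable f W) :
    ∃ w ∈ W, Submodule.span F (Set.range fun n : ℤ => (f ^ n) w) = W := by
  obtain ⟨hs, h0, hmin⟩ := hW
  obtain ⟨w, hw, hw0⟩ := Submodule.exists_mem_ne_zero_of_ne_bot h0
  refine ⟨w, hw, hmin _ ?_ ?_ ?_⟩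
  · rw [Submodule.span_le]
    rintro _ ⟨n, rfl⟩
    exact hs.zpow_mem n w hw
  · intro x hx
    induction hx using Submodule.span_induction with
    | mem x h =>
      obtain ⟨n, rfl⟩ := h
      refine Submodule.subset_span ⟨1 + n, ?_⟩
      simp only [zpow_add, zpow_one]
      rfl
    | zero => simp
    | add x y _ _ h1 h2 => rw [map_add]; exact add_mem h1 h2
    | smul c x _ h => rw [map_smul]; exact Submodule.smul_mem _ _ h
  · intro hb
    apply hw0
    rw [← Submodule.mem_bot F, ← hb]
    exact Submodule.subset_span ⟨0, by simp⟩

theorem stable_orth {B : LinearMap.BilinForm F V} {f : V ≃ₗ[F] V}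
    (hf : ∀ x y, B (f x) (f y) = B x y) {X : Submodule F V} (hX : StableOn f X) :
    StableOn f (B.orthogonal X) := by
  intro v hv x hx
  have := hv _ (hX.symm_mem x hx)
  change B _ _ = 0 at this
  change B _ _ = 0
  rw [← this, ← hf (f.symm x), f.apply_symm_apply]

theorem MinStable.isotropic {B : LinearMap.BilinForm F V} {f : V ≃ₗ[F] V}
    (hsymm : ∀ x y, B x y = B y x)
    (hf : ∀ x y, B (f x) (f y) = B x y) {W : Submodule F V} (hW : MinStable f W)
    (hn : ¬ NDOn B W) : ∀ x ∈ W, ∀ y ∈ W, B x y = 0 := by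
  have h1 : W ⊓ B.orthogonal W = W := by
    refine hW.2.2 _ inf_le_left ?_ ?_
    · exact fun x hx => ⟨hW.1 x hx.1, stable_orth hf hW.1 x hx.2⟩
    · intro hb
      apply hn
      intro x hx h
      rw [← Submodule.mem_bot F, ← hb]
      refine ⟨hx, fun y hy => ?_⟩
      change B y x = 0
      rw [hsymm]; exact h y hy
  intro x hx y hy
  rw [← h1] at hy
  exact hy.2 x hx

theorem exists_good_le {B : LinearMap.BilinForm F V} {f : V ≃ₗ[F] V}
    (hsymm : ∀ x y, B x y = B y x) (hf : ∀ x y, B (f x) (f y) = B x y)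
    (hss : ∀ p, StableOn f p → ∃ q, StableOn f q ∧ IsCompl p q)
    {Z : Submodule F V} (hZs : StableOn f Z) (hZn : NDOn B Z) (hZ0 : Z ≠ ⊥) :
    ∃ Y ≤ Z, Y ≠ ⊥ ∧ GoodOn B f Y := by
  by_cases hcase : ∃ W ≤ Z, MinStable f W ∧ NDOn B W
  · obtain ⟨W, hWZ, hW, hn⟩ := hcase
    obtain ⟨w, hw, hspan⟩ := hW.exists_gen
    refine ⟨W, hWZ, hW.2.1, ?_⟩
    rw [← hspan]
    refine goodOn_span _ (Equiv.addLeft 1) (Equiv.neg ℤ) ?_ ?_ ?_ (by rwa [hspan])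
    · intro n
      simp only [Equiv.coe_addLeft, zpow_add, zpow_one]
      rfl
    · intro n
      simp [Equiv.addLeft]
      try ring
    · intro i j
      simp only [Equiv.neg_apply]
      rw [gram_zpow hf, neg_neg, neg_neg, hsymm]
  · push Not at hcase
    obtain ⟨W, hWZ, hW⟩ := exists_minStable hZs hZ0
    have hWi := hW.isotropic hsymm hf (hcase W hWZ hW)
    let A := Z ⊓ B.orthogonal W
    obtain ⟨C, hCs, hAC⟩ := hss A
      fun x hx => ⟨hZs x hx.1, stable_orth hf hW.1 x hx.2⟩
    have hU0 : C ⊓ Z ≠ ⊥ := by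
      intro hb
      obtain ⟨w, hw, hw0⟩ := Submodule.exists_mem_ne_zero_of_ne_bot hW.2.1
      apply hw0
      refine hZn w (hWZ hw) fun z hz => ?_
      have hz' : z ∈ A ⊔ C := by rw [hAC.sup_eq_top]; trivial
      obtain ⟨a, ha, c, hc, rfl⟩ := Submodule.mem_sup.1 hz'
      have hcZ : c ∈ Z := by simpa using sub_mem hz ha.1
      have : c = 0 := by
        rw [← Submodule.mem_bot F, ← hb]; exact ⟨hc, hcZ⟩
      rw [this, add_zero]
      exact ha.2 w hw
    obtain ⟨U, hUle, hU⟩ := exists_minStable (f := f) (A := C ⊓ Z)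
      (fun x hx => ⟨hCs x hx.1, hZs x hx.2⟩) hU0
    have hUZ : U ≤ Z := hUle.trans inf_le_right
    have hUi := hU.isotropic hsymm hf (hcase U hUZ hU)
    have hU1 : ∀ u ∈ U, (∀ w ∈ W, B w u = 0) → u = 0 := by
      intro u hu h
      have := (Submodule.disjoint_def.1 hAC.disjoint) u ⟨hUZ hu, h⟩ (hUle hu).1
      exact this
    have hW1 : W ⊓ B.orthogonal U = ⊥ := by
      by_contra hne
      have h1 := hW.2.2 _ inf_le_left
        (fun x hx => ⟨hW.1 x hx.1, stable_orth hf hU.1 x hx.2⟩) hne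
      obtain ⟨u, hu, hu0⟩ := Submodule.exists_mem_ne_zero_of_ne_bot hU.2.1
      refine hu0 (hU1 u hu fun w hw => ?_)
      rw [← h1] at hw
      rw [hsymm]
      exact hw.2 u hu
    have hW1' : ∀ w ∈ W, (∀ u ∈ U, B w u = 0) → w = 0 := by
      intro w hw h
      rw [← Submodule.mem_bot F, ← hW1]
      refine ⟨hw, fun u hu => ?_⟩
      change B u w = 0
      rw [hsymm]; exact h u hu
    have hnd : NDOn B (W ⊔ U) := by
      intro z hz h
      obtain ⟨w, hw, u, hu, rfl⟩ := Submodule.mem_sup.1 hz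
      have hu0 : u = 0 := by
        refine hU1 u hu fun w' hw' => ?_
        have := h w' (Submodule.mem_sup_left hw')
        rw [map_add, LinearMap.add_apply, hWi w hw w' hw', zero_add] at this
        rw [hsymm, this]
      subst hu0
      rw [add_zero] at h ⊢
      exact hW1' w hw fun u hu => h u (Submodule.mem_sup_right hu)
    obtain ⟨w, hw, hwspan⟩ := hW.exists_gen
    obtain ⟨u, hu, huspan⟩ := hU.exists_gen
    refine ⟨W ⊔ U, sup_le hWZ hUZ, ?_, ?_⟩
    · intro hb
      exact hW.2.1 (eq_bot_iff.2 (hb ▸ le_sup_left))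
    · let a : ℤ ⊕ ℤ → V := Sum.elim (fun n => (f ^ n) w) (fun n => (f ^ n) u)
      have hspan : Submodule.span F (Set.range a) = W ⊔ U := by
        rw [Set.Sum.elim_range, Submodule.span_union, hwspan, huspan]
      rw [← hspan] at hnd ⊢
      refine goodOn_span a ((Equiv.addLeft 1).sumCongr (Equiv.addLeft 1))
        (((Equiv.neg ℤ).sumCongr (Equiv.neg ℤ)).trans (Equiv.sumComm ℤ ℤ)) ?_ ?_ ?_ hnd
      · rintro (n | n) <;>
        · simp only [a, Equiv.sumCongr_apply, Sum.map_inl, Sum.map_inr, Sum.elim_inl,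
            Sum.elim_inr, Equiv.coe_addLeft, zpow_add, zpow_one]
          rfl
      · rintro (n | n) <;> simp [Equiv.addLeft] <;> try ring
      · have hww : ∀ n k : ℤ, B ((f ^ n) w) ((f ^ k) w) = 0 := fun n k =>
          hWi _ (hW.1.zpow_mem n w hw) _ (hW.1.zpow_mem k w hw)
        have huu : ∀ n k : ℤ, B ((f ^ n) u) ((f ^ k) u) = 0 := fun n k =>
          hUi _ (hU.1.zpow_mem n u hu) _ (hU.1.zpow_mem k u hu)
        rintro (n | n) (k | k)
        · exact (huu (-n) (-k)).trans (hww n k).symm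
        · change B ((f ^ (-n)) u) ((f ^ (-k)) w) = B ((f ^ n) w) ((f ^ k) u)
          rw [gram_zpow hf, neg_neg, neg_neg, hsymm]
        · change B ((f ^ (-n)) w) ((f ^ (-k)) u) = B ((f ^ n) u) ((f ^ k) w)
          rw [gram_zpow hf, neg_neg, neg_neg, hsymm]
        · exact (hww (-n) (-k)).trans (huu n k).symm

/-- A semisimple isometry is inverted by some isometry. -/
theorem exists_inverting {B : LinearMap.BilinForm F V} {f : V ≃ₗ[F] V}
    (hsymm : ∀ x y, B x y = B y x) (hnd : ∀ x, (∀ y, B x y = 0) → x = 0)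
    (hf : ∀ x y, B (f x) (f y) = B x y)
    (hss : ∀ p, StableOn f p → ∃ q, StableOn f q ∧ IsCompl p q) :
    ∃ g : V ≃ₗ[F] V, (∀ x y, B (g x) (g y) = B x y) ∧ ∀ x, g (f x) = f.symm (g x) := by
  have hbot : GoodOn B f ⊥ := by
    refine ⟨?_, ?_, 0, ?_, ?_, ?_⟩
    · intro x hx; rw [Submodule.mem_bot] at *; simp [hx]
    · intro x hx _; simpa using hx
    · intro x hx; simp
    · intro x hx y hy; rw [Submodule.mem_bot] at *; simp [hx]
    · intro x hx; simp
  obtain ⟨X, hX, hmax⟩ := (wellFounded_gt (α := Submodule F V)).has_min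
    {X | GoodOn B f X} ⟨⊥, hbot⟩
  have hc := isCompl_orth hsymm hX.2.1
  have hZ : B.orthogonal X = ⊥ := by
    by_contra hZ0
    have hZn : NDOn B (B.orthogonal X) := by
      intro z hz h
      refine hnd z fun v => ?_
      have hv : v ∈ X ⊔ B.orthogonal X := by rw [hc.sup_eq_top]; trivial
      obtain ⟨x, hx, y, hy, rfl⟩ := Submodule.mem_sup.1 hv
      rw [map_add, h y hy, hsymm, add_zero]
      exact hz x hx
    obtain ⟨Y, hYZ, hY0, hY⟩ := exists_good_le hsymm hf hss (stable_orth hf hX.1) hZn hZ0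
    have hgood := hX.sup hsymm hY fun x hx y hy => hYZ hy x hx
    refine hmax _ hgood (lt_of_le_of_ne le_sup_left fun heq => hY0 ?_)
    have hYX : Y ≤ X := by rw [heq]; exact le_sup_right
    exact eq_bot_iff.2 (hc.inf_eq_bot ▸ le_inf hYX hYZ)
  have hXt : X = ⊤ := by
    have := hc.sup_eq_top
    rwa [hZ, sup_bot_eq] at this
  subst hXt
  obtain ⟨-, -, g, -, hgi, hgf⟩ := hX
  have hinj : Function.Injective g := by
    rw [← LinearMap.ker_eq_bot, LinearMap.ker_eq_bot']
    intro x hx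
    refine hnd x fun y => ?_
    rw [← hgi x trivial y trivial, hx, map_zero, LinearMap.zero_apply]
  refine ⟨LinearEquiv.ofInjectiveEndo g hinj, fun x y => ?_, fun x => ?_⟩
  · simpa using hgi x trivial y trivial
  · simpa using hgf x trivial

end

theorem det_isometry_sq {F V : Type*} [Field F] [AddCommGroup V] [Module F V]
    [FiniteDimensional F V] (B : LinearMap.BilinForm F V) (hB : B.Nondegenerate)
    (g : V →ₗ[F] V) (hg : ∀ x y, B (g x) (g y) = B x y) :
    LinearMap.det g = 1 ∨ LinearMap.det g = -1 := by
  let b := Module.finBasis F V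
  have h0 := (LinearMap.BilinForm.nondegenerate_iff_det_ne_zero b).1 hB
  have hcomp : B.comp g g = B := by
    ext a c
    simp [hg]
  have hM := congrArg Matrix.det (LinearMap.BilinForm.toMatrix_comp b b B g g)
  rw [hcomp, Matrix.det_mul, Matrix.det_mul, Matrix.det_transpose, LinearMap.det_toMatrix] at hM
  have h1 : LinearMap.det g * LinearMap.det g = 1 := by
    apply mul_right_cancel₀ h0
    rw [one_mul]
    conv_rhs => rw [hM]
    ring
  exact mul_self_eq_one_iff.1 h1

/-- A semisimple isometry with eigenvalue `ε = ±1` has an anisotropic `ε`-eigenvector. -/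
theorem exists_aniso {F V : Type*} [Field F] [AddCommGroup V] [Module F V]
    [FiniteDimensional F V] {B : LinearMap.BilinForm F V} {f : V ≃ₗ[F] V}
    (hF2 : (2 : F) ≠ 0)
    (hsymm : ∀ x y, B x y = B y x) (hnd : ∀ x, (∀ y, B x y = 0) → x = 0)
    (hf : ∀ x y, B (f x) (f y) = B x y)
    (hss : ∀ p, StableOn f p → ∃ q, StableOn f q ∧ IsCompl p q)
    (e : F) (he : e * e = 1) (v : V) (hv : v ≠ 0) (hfv : f v = e • v) :
    ∃ c, f c = e • c ∧ B c c ≠ 0 := by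
  by_contra! hcon
  let E : Submodule F V := LinearMap.ker ((f : V →ₗ[F] V) - e • LinearMap.id)
  have hE : ∀ x, x ∈ E ↔ f x = e • x := by
    intro x
    simp [E, sub_eq_zero]
  have hEs : StableOn f E := by
    intro x hx
    have := (hE x).1 hx
    rw [this]
    exact E.smul_mem e hx
  have hEi : ∀ x ∈ E, ∀ y ∈ E, B x y = 0 := by
    intro x hx y hy
    have h1 := hcon _ ((hE _).1 (add_mem hx hy))
    have h2 := hcon _ ((hE _).1 hx)
    have h3 := hcon _ ((hE _).1 hy)
    simp only [map_add, LinearMap.add_apply, h2, h3, hsymm y x] at h1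
    have h4 : 2 * B x y = 0 := by linear_combination h1
    exact (mul_eq_zero.1 h4).resolve_left hF2
  obtain ⟨C, hCs, hc⟩ := hss _ (stable_orth hf hEs)
  have hvE : v ∈ E := (hE v).2 hfv
  apply hv
  refine hnd v fun y => ?_
  have hy : y ∈ B.orthogonal E ⊔ C := by rw [hc.sup_eq_top]; trivial
  obtain ⟨a, ha, c, hcC, rfl⟩ := Submodule.mem_sup.1 hy
  have h1 : f c - e • c = 0 := by
    refine Submodule.disjoint_def.1 hc.disjoint _ ?_
      (sub_mem (hCs c hcC) (C.smul_mem e hcC))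
    intro x hx
    change B x _ = 0
    have h2 : B (f x) (f c) = B x c := hf x c
    rw [(hE x).1 hx, map_smul, LinearMap.smul_apply, smul_eq_mul] at h2
    rw [map_sub, map_smul, smul_eq_mul, ← h2]
    linear_combination (-B x (f c)) * he
  have hcE : c ∈ E := (hE c).2 (sub_eq_zero.1 h1)
  rw [map_add, hEi v hvE c hcE, add_zero]
  exact ha v hvE

/-- Reflection in an anisotropic eigenvector. -/
theorem exists_refl {F V : Type*} [Field F] [AddCommGroup V] [Module F V]
    [FiniteDimensional F V] {B : LinearMap.BilinForm F V} {f : V ≃ₗ[F] V}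
    (hsymm : ∀ x y, B x y = B y x)
    (hf : ∀ x y, B (f x) (f y) = B x y)
    (e : F) (he : e * e = 1) (c : V) (hfc : f c = e • c) (hcc : B c c ≠ 0) :
    ∃ r : V ≃ₗ[F] V, (∀ x y, B (r x) (r y) = B x y) ∧ (∀ x, r (f x) = f (r x)) ∧
      LinearMap.det (r : V →ₗ[F] V) = -1 := by
  let φ : Module.Dual F V := (-(2 / B c c)) • B c
  have hφ : ∀ x, φ x = -(2 / B c c) * B c x := fun x => rfl
  let t := LinearMap.transvection φ c
  have ht : ∀ x, t x = x + (-(2 / B c c) * B c x) • c := fun x => rfl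
  have hdet : LinearMap.det t = -1 := by
    rw [LinearMap.transvection.det, hφ]
    field_simp
    ring
  have hinv : t ∘ₗ t = LinearMap.id := by
    ext x
    simp only [LinearMap.comp_apply, LinearMap.id_apply, ht]
    simp only [map_add, map_smul, smul_eq_mul]
    rw [add_assoc, ← add_smul]
    convert add_zero x
    rw [show -(2 / B c c) * B c x + -(2 / B c c) * (B c x + -(2 / B c c) * B c x * B c c) = 0 by
      field_simp
      ring, zero_smul]
  have hcf : ∀ x, B c (f x) = e * B c x := by
    intro x
    have h2 := hf c x
    rw [hfc, map_smul, LinearMap.smul_apply, smul_eq_mul] at h2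
    rw [← h2]
    linear_combination (-B c (f x)) * he
  refine ⟨LinearEquiv.ofLinearMap t t hinv hinv, fun x y => ?_, fun x => ?_, hdet⟩
  · change B (t x) (t y) = B x y
    simp only [ht, map_add, map_smul, LinearMap.add_apply, LinearMap.smul_apply, smul_eq_mul,
      hsymm x c]
    field_simp
    ring
  · change t (f x) = f (t x)
    simp only [ht, map_add, map_smul, hcf, hfc, smul_smul]
    congr 2
    ring


/-- Over a field of characteristic `≠ 2`, with `q` nondegenerate and
`dim V = 2m` with `m` odd: a semisimple element `f ∈ SO(q)` is real in `SO(q)` if and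
only if `1` or `−1` is an eigenvalue of `f`. -/
theorem stmt10 {F V : Type*} [Field F] [AddCommGroup V] [Module F V] [FiniteDimensional F V]
    (hF2 : (2 : F) ≠ 0) (Q : QuadraticForm F V)
    (hQ : LinearMap.BilinForm.Nondegenerate (QuadraticMap.polarBilin Q))
    (m : ℕ) (hm : Odd m) (hdim : Module.finrank F V = 2 * m)
    (f : V ≃ₗ[F] V) (hfq : ∀ v, Q (f v) = Q v)
    (hfd : LinearMap.det (f : V →ₗ[F] V) = 1)
    (hss : Module.End.IsSemisimple (f : V →ₗ[F] V)) :
    (∃ g : V ≃ₗ[F] V, (∀ v, Q (g v) = Q v) ∧ LinearMap.det (g : V →ₗ[F] V) = 1 ∧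
      g * f * g⁻¹ = f⁻¹) ↔
    (∃ v : V, v ≠ 0 ∧ (f v = v ∨ f v = -v)) := by
  set B : LinearMap.BilinForm F V := QuadraticMap.polarBilin Q with hBdef
  have hBa : ∀ x y, B x y = Q (x + y) - Q x - Q y := fun x y => rfl
  have hsymm : ∀ x y, B x y = B y x := by
    intro x y
    rw [hBa, hBa, add_comm x y]
    ring
  have hnd : ∀ x, (∀ y, B x y = 0) → x = 0 := hQ.1
  have hiso : ∀ g : V ≃ₗ[F] V, (∀ v, Q (g v) = Q v) → ∀ x y, B (g x) (g y) = B x y := by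
    intro g hg x y
    rw [hBa, hBa, ← map_add, hg, hg, hg]
  have hiso' : ∀ g : V ≃ₗ[F] V, (∀ x y, B (g x) (g y) = B x y) → ∀ v, Q (g v) = Q v := by
    intro g hg v
    have hself : ∀ x, B x x = 2 * Q x := by
      intro x
      have h := QuadraticMap.polar_self Q x
      rw [two_nsmul, ← two_mul] at h
      exact h
    have h := hg v v
    rw [hself, hself] at h
    exact mul_left_cancel₀ hF2 h
  have hf := hiso f hfq
  have hss' : ∀ p, StableOn f p → ∃ q, StableOn f q ∧ IsCompl p q := by
    intro p hp
    obtain ⟨q, hq, hpq⟩ := Module.End.isSemisimple_iff.1 hss p hp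
    exact ⟨q, hq, hpq⟩
  have hconj : ∀ g : V ≃ₗ[F] V, g * f * g⁻¹ = f⁻¹ ↔ ∀ x, g (f x) = f.symm (g x) := by
    intro g
    rw [mul_inv_eq_iff_eq_mul]
    constructor
    · intro h x
      exact LinearEquiv.congr_fun h x
    · intro h
      ext x
      exact h x
  constructor
  · rintro ⟨g, hgq, hgd, hg⟩
    by_contra hev
    have h := stmt10_forward B hsymm hnd m hm.pos hdim f hf hev g (hiso g hgq) ((hconj g).1 hg)
    rw [hgd, hm.neg_one_pow] at h
    apply hF2
    linear_combination h
  · rintro ⟨v, hv0, hv⟩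
    obtain ⟨e, he, hfv⟩ : ∃ e : F, e * e = 1 ∧ f v = e • v := by
      rcases hv with hv | hv
      · exact ⟨1, by simp, by simp [hv]⟩
      · exact ⟨-1, by simp, by simp [hv]⟩
    obtain ⟨c, hfc, hcc⟩ := exists_aniso hF2 hsymm hnd hf hss' e he v hv0 hfv
    obtain ⟨r, hri, hrf, hrd⟩ := exists_refl hsymm hf e he c hfc hcc
    obtain ⟨g, hgi, hgf⟩ := exists_inverting hsymm hnd hf hss'
    rcases det_isometry_sq B hQ (g : V →ₗ[F] V) hgi with hd | hd
    · exact ⟨g, hiso' g hgi, hd, (hconj g).2 hgf⟩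
    · refine ⟨g * r, hiso' _ fun x y => ?_, ?_, (hconj _).2 fun x => ?_⟩
      · change B (g (r x)) (g (r y)) = B x y
        rw [hgi, hri]
      · change LinearMap.det ((g : V →ₗ[F] V) ∘ₗ (r : V →ₗ[F] V)) = 1
        rw [LinearMap.det_comp, hd, hrd]
        ring
      · change g (r (f x)) = f.symm (g (r x))
        rw [hrf, hgf]
end
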